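/- Let X ∈ ℝ^{d×r} satisfy XᵀX = I_r and let E ∈ ℝ^{d×r} satisfy XᵀE + EᵀX = 0. For t ≥ 0, the matrix I_r + t²·EᵀE is positive definite; let H(t) denote its positive semidefinite square root and define the polar-decomposition retraction Y(t) = (X + tE)·H(t)⁻¹. Then for all t ≥ 0: ‖Y(t) − X − tE‖_F ≤ (1/2)·t²·‖E‖_F². -/

import Mathlib

open Matrix

/-- Frobenius norm of a real matrix. -/
noncomputable def frobNorm {d r : ℕ} (A : Matrix (Fin d) (Fin r) ℝ) : ℝ :=
  Real.sqrt (∑ i, ∑ j, (A i j) ^ 2)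

theorem frobNorm_nonneg {d r : ℕ} (A : Matrix (Fin d) (Fin r) ℝ) : 0 ≤ frobNorm A :=
  Real.sqrt_nonneg _

theorem frobNorm_sq {d r : ℕ} (A : Matrix (Fin d) (Fin r) ℝ) :
    frobNorm A ^ 2 = (Aᵀ * A).trace := by
  rw [frobNorm, Real.sq_sqrt (by positivity), Finset.sum_comm]
  simp [Matrix.trace, Matrix.mul_apply, sq]

section
attribute [local instance] Matrix.frobeniusNormedAddCommGroup

theorem frobNorm_eq_norm {d r : ℕ} (A : Matrix (Fin d) (Fin r) ℝ) : frobNorm A = ‖A‖ := by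
  rw [frobNorm, Matrix.frobenius_norm_def, Real.sqrt_eq_rpow]
  simp

theorem frobNorm_transpose_mul_self_le {d r : ℕ} (A : Matrix (Fin d) (Fin r) ℝ) :
    frobNorm (Aᵀ * A) ≤ frobNorm A ^ 2 := by
  rw [frobNorm_eq_norm, frobNorm_eq_norm, sq]
  simpa using Matrix.frobenius_norm_mul Aᵀ A

end

theorem frobNorm_smul_of_nonneg {d r : ℕ} {c : ℝ} (hc : 0 ≤ c)
    (A : Matrix (Fin d) (Fin r) ℝ) : frobNorm (c • A) = c * frobNorm A := by
  rw [← sq_eq_sq₀ (frobNorm_nonneg _) (mul_nonneg hc (frobNorm_nonneg _)), mul_pow,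
    frobNorm_sq, frobNorm_sq]
  simp [sq, mul_assoc]

/-- If `H` is positive semidefinite and `1 ≤ H²` in the Loewner order, then `1 ≤ H`. -/
theorem Matrix.PosSemidef.sub_one_of_sq {r : ℕ} {H S : Matrix (Fin r) (Fin r) ℝ}
    (hH : H.PosSemidef) (hS : S.PosSemidef) (h : H * H = 1 + S) : (H - 1).PosSemidef := by
  have hK : (H - 1).IsHermitian := hH.1.sub Matrix.isHermitian_one
  rw [hK.posSemidef_iff_eigenvalues_nonneg]
  intro i
  set k := hK.eigenvalues i with hk
  set v : Fin r → ℝ := ⇑(hK.eigenvectorBasis i) with hv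
  have hKv : (H - 1) *ᵥ v = k • v := hK.mulVec_eigenvectorBasis i
  have hHv : H *ᵥ v = (k + 1) • v := by
    have : H *ᵥ v - v = k • v := by simpa [Matrix.sub_mulVec] using hKv
    rw [add_smul, one_smul, ← this, sub_add_cancel]
  have hSv : S *ᵥ v = (k * (k + 2)) • v := by
    have h1 : (H * H) *ᵥ v = v + S *ᵥ v := by rw [h, Matrix.add_mulVec, Matrix.one_mulVec]
    rw [← Matrix.mulVec_mulVec, hHv, Matrix.mulVec_smul, hHv, smul_smul] at h1
    rw [eq_sub_of_add_eq' h1.symm]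
    module
  have hpos : 0 < v ⬝ᵥ v := by
    have hv0 : v ≠ 0 := fun h0 =>
      hK.eigenvectorBasis.orthonormal.ne_zero i (by ext j; exact congrFun h0 j)
    have hnn : 0 ≤ v ⬝ᵥ v := Finset.sum_nonneg fun j _ => mul_self_nonneg (v j)
    exact lt_of_le_of_ne hnn fun h0 => hv0 (dotProduct_self_eq_zero.mp h0.symm)
  have h1 : 0 ≤ (k + 1) * (v ⬝ᵥ v) := by
    simpa [hHv, dotProduct_smul] using hH.dotProduct_mulVec_nonneg v
  have h2 : 0 ≤ (k * (k + 2)) * (v ⬝ᵥ v) := by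
    simpa [hSv, dotProduct_smul] using hS.dotProduct_mulVec_nonneg v
  have h3 := nonneg_of_mul_nonneg_left h1 hpos
  have h4 := nonneg_of_mul_nonneg_left h2 hpos
  exact nonneg_of_mul_nonneg_left h4 (by linarith)

/-- For positive semidefinite `K`, `2 ‖K‖_F ≤ ‖K² + 2K‖_F`. -/
theorem Matrix.PosSemidef.two_mul_frobNorm_le {r : ℕ} {K : Matrix (Fin r) (Fin r) ℝ}
    (hK : K.PosSemidef) : 2 * frobNorm K ≤ frobNorm (K * K + (2 : ℝ) • K) := by
  have hT : Kᵀ = K := by simpa using hK.1.eq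
  rw [← sq_le_sq₀ (by linarith [frobNorm_nonneg K]) (frobNorm_nonneg _), mul_pow,
    frobNorm_sq, frobNorm_sq]
  have h3 : 0 ≤ (K * K * K).trace := by
    simpa [hT] using (hK.mul_mul_conjTranspose_same K).trace_nonneg
  have h4 : 0 ≤ (K * K * (K * K)).trace := by
    have := frobNorm_sq (K * K)
    rw [transpose_mul, hT] at this
    rw [← this]
    positivity
  have hexp : (K * K + (2 : ℝ) • K)ᵀ * (K * K + (2 : ℝ) • K)
      = K * K * (K * K) + (4 : ℝ) • (K * K * K) + (4 : ℝ) • (K * K) := by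
    simp only [transpose_add, transpose_mul, transpose_smul, hT, add_mul, mul_add,
      smul_mul_assoc, mul_smul_comm, mul_assoc]
    module
  rw [hexp, hT]
  simp only [trace_add, trace_smul, smul_eq_mul]
  linarith

/-- for the polar-decomposition retraction `Y(t) = (X + tE)·H(t)⁻¹`,
one has `‖Y(t) − X − tE‖_F ≤ (1/2)·t²·‖E‖_F²` for all `t ≥ 0`. -/
theorem stmt_8 {d r : ℕ} (X E : Matrix (Fin d) (Fin r) ℝ)
    (hX : Xᵀ * X = 1) (hE : Xᵀ * E + Eᵀ * X = 0) :
    ∀ t : ℝ, 0 ≤ t →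
      ((1 + t ^ 2 • (Eᵀ * E)).PosDef ∧
        ∀ H : Matrix (Fin r) (Fin r) ℝ, H.PosSemidef →
          H * H = 1 + t ^ 2 • (Eᵀ * E) →
            frobNorm ((X + t • E) * H⁻¹ - X - t • E)
              ≤ (1 / 2) * t ^ 2 * frobNorm E ^ 2) := by
  intro t _
  have hS : (t ^ 2 • (Eᵀ * E)).PosSemidef := by
    simpa using (Matrix.posSemidef_conjTranspose_mul_self E).smul (sq_nonneg t)
  have hpd : (1 + t ^ 2 • (Eᵀ * E)).PosDef := Matrix.PosDef.one.add_posSemidef hS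
  refine ⟨hpd, fun H hH hHH => ?_⟩
  have hT : Hᵀ = H := by simpa using hH.1.eq
  have hdet : IsUnit H.det := by
    have := hpd.det_pos.ne'
    rw [← hHH, det_mul] at this
    exact (left_ne_zero_of_mul this).isUnit
  have hgram : (X + t • E)ᵀ * (X + t • E) = H * H := by
    rw [hHH]
    have : (X + t • E)ᵀ * (X + t • E)
        = Xᵀ * X + t • (Xᵀ * E + Eᵀ * X) + t ^ 2 • (Eᵀ * E) := by
      simp only [transpose_add, transpose_smul, Matrix.add_mul, Matrix.mul_add,
        Matrix.smul_mul, Matrix.mul_smul]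
      module
    rw [this, hX, hE, smul_zero, add_zero]
  have hnorm : frobNorm ((X + t • E) * H⁻¹ - X - t • E) = frobNorm (H - 1) := by
    rw [← sq_eq_sq₀ (frobNorm_nonneg _) (frobNorm_nonneg _), frobNorm_sq, frobNorm_sq]
    have h1 : (X + t • E) * H⁻¹ - X - t • E = (X + t • E) * (H⁻¹ - 1) := by
      rw [Matrix.mul_sub, Matrix.mul_one, sub_sub]
    have h2 : H * (H⁻¹ - 1) = -(H - 1) := by
      rw [Matrix.mul_sub, Matrix.mul_nonsing_inv _ hdet, Matrix.mul_one, neg_sub]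
    have h3 : ((X + t • E) * (H⁻¹ - 1))ᵀ * ((X + t • E) * (H⁻¹ - 1))
        = (H * (H⁻¹ - 1))ᵀ * (H * (H⁻¹ - 1)) := by
      rw [transpose_mul, Matrix.mul_assoc, ← Matrix.mul_assoc (X + t • E)ᵀ, hgram,
        transpose_mul, hT]
      simp only [Matrix.mul_assoc]
    rw [h1, h3, h2, transpose_neg, neg_mul_neg]
  have hK := (hH.sub_one_of_sq hS hHH).two_mul_frobNorm_le
  have hsq : (H - 1) * (H - 1) + (2 : ℝ) • (H - 1) = t ^ 2 • (Eᵀ * E) := by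
    rw [← add_sub_cancel_left 1 (t ^ 2 • (Eᵀ * E)), ← hHH, two_smul]
    noncomm_ring
  rw [hsq, frobNorm_smul_of_nonneg (sq_nonneg t)] at hK
  have := mul_le_mul_of_nonneg_left (frobNorm_transpose_mul_self_le E) (sq_nonneg t)
  rw [hnorm]
  linarith
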